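/- Transporting the Weyl algebra multiplication through the symmetrization map yields the Moyal product: for all f, g ∈ k[V][h], φ_W(f *_h g) = φ_W(f)·φ_W(g) in A_h(V). -/

import Mathlib

open MvPolynomial

noncomputable section

variable {k : Type*} [Field k] [CharZero k]
variable {σ : Type*} [Fintype σ] [DecidableEq σ]

/-- `f ⊗ g` as a polynomial in a doubled set of variables. -/
def tens (f g : MvPolynomial σ (Polynomial k)) :
    MvPolynomial (σ ⊕ σ) (Polynomial k) :=
  rename Sum.inl f * rename Sum.inr g

/-- The bivector `π ∈ ∧²V ⊆ V ⊗ V` acting as a second-order constant-coefficient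
bidifferential operator on `k[V] ⊗ k[V]`. -/
def piOp (π : σ → σ → k) (p : MvPolynomial (σ ⊕ σ) (Polynomial k)) :
    MvPolynomial (σ ⊕ σ) (Polynomial k) :=
  ∑ i : σ, ∑ j : σ,
    Polynomial.C (π i j) • pderiv (Sum.inl i) (pderiv (Sum.inr j) p)

/-- The commutative multiplication `m : k[V] ⊗ k[V] → k[V]`. -/
def joinMul : MvPolynomial (σ ⊕ σ) (Polynomial k) →ₐ[Polynomial k] MvPolynomial σ (Polynomial k) :=
  aeval (Sum.elim X X)

/-- The Moyal star product `f *ₕ g = m ∘ e^{(h/2)π} (f ⊗ g)`; the exponential series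
is finite on each pair of arguments (all terms of order `> deg f + deg g` vanish). -/
def moyal (π : σ → σ → k) (f g : MvPolynomial σ (Polynomial k)) :
    MvPolynomial σ (Polynomial k) :=
  ∑ d ∈ Finset.range (f.totalDegree + g.totalDegree + 1),
    (Polynomial.C ((2 ^ d * d.factorial : k)⁻¹) * Polynomial.X ^ d) •
      joinMul ((piOp π)^[d] (tens f g))

/-- The inclusion `k[V] → k[V][h]`. -/
def liftC : MvPolynomial σ k →+* MvPolynomial σ (Polynomial k) :=
  MvPolynomial.map (Polynomial.C : k →+* Polynomial k)

/-- The relations of the Weyl algebra `A_h(V)`: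
`u ⊗ u' − u' ⊗ u = h·⟨π, u ⊗ u'⟩` for `u, u'` in a basis of `V*`. -/
inductive weylRel {k : Type*} [Field k] {ι : Type*} (π : ι → ι → k) :
    FreeAlgebra (Polynomial k) ι → FreeAlgebra (Polynomial k) ι → Prop
  | comm (i j : ι) : weylRel π
      (FreeAlgebra.ι (Polynomial k) i * FreeAlgebra.ι (Polynomial k) j
        - FreeAlgebra.ι (Polynomial k) j * FreeAlgebra.ι (Polynomial k) i)
      (algebraMap (Polynomial k) _ (Polynomial.X * Polynomial.C (π i j)))

/-- The Weyl algebra `A_h(V) = (TV*)[h]/I(u⊗u' − u'⊗u − h⟨π, u⊗u'⟩)`. -/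
abbrev Weyl {k : Type*} [Field k] {ι : Type*} (π : ι → ι → k) :=
  RingQuot (weylRel π)

variable {k : Type*} [Field k] [CharZero k]
variable {ι : Type*} [Fintype ι] [DecidableEq ι]

/-- The symmetrization of a single monomial: the average over all orderings of its
variables of the corresponding product in the Weyl algebra. -/
noncomputable def symMon (π : ι → ι → k) (m : ι →₀ ℕ) : Weyl π :=
  algebraMap (Polynomial k) (Weyl π)
      (Polynomial.C (((Finsupp.toMultiset m).toList.length.factorial : k)⁻¹)) *
    ∑ s : Equiv.Perm (Fin (Finsupp.toMultiset m).toList.length),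
      (List.ofFn fun t =>
        RingQuot.mkAlgHom (Polynomial k) (weylRel π)
          (FreeAlgebra.ι (Polynomial k) ((Finsupp.toMultiset m).toList.get (s t)))).prod

/-- The symmetrization map `φ_W : k[V][h] → A_h(V)`. -/
noncomputable def phiW (π : ι → ι → k)
    (f : MvPolynomial ι (Polynomial k)) : Weyl π :=
  ∑ m ∈ f.support, MvPolynomial.coeff m f • symMon π m


set_option linter.unusedSectionVars false

section Symmetrization

variable {A B : Type*} [Ring A]

/-- The sum, over all orderings, of the products of a finite family in a ring. -/
def permSum {n : ℕ} (a : Fin n → A) : A :=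
  ∑ s : Equiv.Perm (Fin n), (List.ofFn fun t => a (s t)).prod

theorem permSum_comp_perm {n : ℕ} (a : Fin n → A) (e : Equiv.Perm (Fin n)) :
    permSum (a ∘ e) = permSum a :=
  Fintype.sum_equiv (Equiv.mulLeft e) _ _ fun _ => rfl

theorem exists_perm_of_map_univ_eq {n : ℕ} [DecidableEq B] {a b : Fin n → B}
    (h : Finset.univ.val.map a = Finset.univ.val.map b) :
    ∃ e : Equiv.Perm (Fin n), b ∘ e = a := by
  have key (c : B) : Nonempty ({i // a i = c} ≃ {i // b i = c}) := by
    rw [← Fintype.card_eq, Fintype.card_subtype, Fintype.card_subtype]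
    have := congrArg (Multiset.count c) h
    simpa only [Multiset.count_map, Finset.card_def, Finset.filter_val, eq_comm] using this
  exact ⟨Equiv.ofFiberEquiv fun c => (key c).some, funext fun i =>
    Equiv.ofFiberEquiv_map (fun c => (key c).some) i⟩

theorem permSum_succ {n : ℕ} (a : Fin (n + 1) → A) :
    permSum a = ∑ p, a p * permSum fun t => a (Equiv.swap 0 p t.succ) := by
  unfold permSum
  rw [← Equiv.sum_comp Equiv.Perm.decomposeFin.symm, Fintype.sum_prod_type]
  refine Finset.sum_congr rfl fun p _ => ?_
  rw [Finset.mul_sum]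
  refine Finset.sum_congr rfl fun e _ => ?_
  rw [List.ofFn_succ, List.prod_cons]
  simp

/-- The sum, over all orderings of a multiset of indices, of the products of a family. -/
def multisetPermSum (x : B → A) (M : Multiset B) : A :=
  permSum fun t : Fin M.toList.length => x (M.toList.get t)

theorem permSum_eq_multisetPermSum [DecidableEq B] (x : B → A) {n : ℕ} (a : Fin n → B)
    {M : Multiset B} (h : Finset.univ.val.map a = M) :
    permSum (fun t => x (a t)) = multisetPermSum x M := by
  obtain rfl : n = M.toList.length := by
    rw [Multiset.length_toList, ← h]
    simp
  have h' : Finset.univ.val.map a = Finset.univ.val.map M.toList.get := by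
    rw [h, Fin.univ_val_map, List.ofFn_get, Multiset.coe_toList]
  obtain ⟨e, rfl⟩ := exists_perm_of_map_univ_eq h'
  exact permSum_comp_perm (fun t => x (M.toList.get t)) e

theorem multisetPermSum_zero (x : B → A) : multisetPermSum x 0 = 1 := by
  classical
  rw [← permSum_eq_multisetPermSum x (Fin.elim0 : Fin 0 → B) (by simp)]
  simp [permSum]

theorem multisetPermSum_eq_sum_erase [DecidableEq B] (x : B → A) {M : Multiset B} (hM : M ≠ 0) :
    multisetPermSum x M = (M.map fun b => x b * multisetPermSum x (M.erase b)).sum := by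
  obtain ⟨n, hn⟩ : ∃ n, M.toList.length = n + 1 :=
    Nat.exists_eq_succ_of_ne_zero (by simpa using hM)
  obtain ⟨a, ha⟩ : ∃ a : Fin (n + 1) → B, Finset.univ.val.map a = M := by
    refine ⟨fun t => M.toList.get (t.cast hn.symm), ?_⟩
    rw [Fin.univ_val_map, ← List.ofFn_congr hn, List.ofFn_get, Multiset.coe_toList]
  have hmap (F : B → A) : (M.map F).sum = ∑ p, F (a p) := by
    rw [← ha, Multiset.map_map]
    rfl
  rw [← permSum_eq_multisetPermSum x a ha, permSum_succ, hmap]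
  refine Finset.sum_congr rfl fun p _ => ?_
  congr 1
  refine permSum_eq_multisetPermSum x (fun t => a (Equiv.swap 0 p t.succ)) ?_
  have h2 : Finset.univ.val.map (fun t => a (Equiv.swap 0 p t)) = M := by
    rw [← ha]
    conv_rhs => rw [← Multiset.map_univ_val_equiv (Equiv.swap 0 p), Multiset.map_map]
    rfl
  rw [Fin.univ_val_map, List.ofFn_succ, ← Multiset.cons_coe] at h2
  rw [← h2, Fin.univ_val_map]
  simp

end Symmetrization

section Operators

variable {R : Type*} [CommRing R]

theorem MvPolynomial.pderiv_comm {τ : Type*} (i j : τ) (p : MvPolynomial τ R) :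
    pderiv i (pderiv j p) = pderiv j (pderiv i p) := by
  classical
  have h : ⁅pderiv (R := R) i, pderiv (R := R) j⁆ = 0 := by
    refine MvPolynomial.derivation_ext (R := R) fun l => ?_
    rw [Derivation.commutator_apply, pderiv_X, pderiv_X, Pi.single_apply, Pi.single_apply]
    split_ifs <;> simp
  have := congrArg (fun d => d p) h
  rwa [Derivation.commutator_apply, Derivation.zero_apply, sub_eq_zero] at this

theorem MvPolynomial.totalDegree_pderiv_le {τ : Type*} (i : τ) {p : MvPolynomial τ R} {n : ℕ}
    (h : p.totalDegree ≤ n + 1) : (pderiv i p).totalDegree ≤ n := by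
  classical
  refine Finset.sup_le fun m hm => ?_
  rw [mem_support_iff, coeff_pderiv] at hm
  have h2 := (le_totalDegree (mem_support_iff.2 (left_ne_zero_of_mul hm))).trans h
  rw [Finsupp.sum_add_index' (by simp) (by simp), Finsupp.sum_single_index rfl] at h2
  omega

end Operators

section Moyal

theorem pderiv_joinMul (i : ι) (p : MvPolynomial (ι ⊕ ι) (Polynomial k)) :
    pderiv i (joinMul p) = joinMul (pderiv (Sum.inl i) p + pderiv (Sum.inr i) p) := by
  induction p using MvPolynomial.induction_on with
  | C a => simp [joinMul]
  | add p q hp hq =>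
    simp only [map_add] at hp hq ⊢
    rw [hp, hq]
    ring
  | mul_X p j hp =>
    have hX : pderiv i (joinMul (X j : MvPolynomial (ι ⊕ ι) (Polynomial k))) =
        joinMul (pderiv (Sum.inl i) (X j)) + joinMul (pderiv (Sum.inr i) (X j)) := by
      rcases j with j | j <;> by_cases h : j = i
      · subst h
        simp [joinMul, pderiv_X]
      · simp [joinMul, pderiv_X, h]
      · subst h
        simp [joinMul, pderiv_X]
      · simp [joinMul, pderiv_X, h]
    simp only [map_mul, map_add, Derivation.leibniz, smul_eq_mul] at hp ⊢
    rw [hp, hX]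
    ring

/-- `piOp` as a linear endomorphism. -/
def piEnd (π : ι → ι → k) : Module.End (Polynomial k) (MvPolynomial (ι ⊕ ι) (Polynomial k)) :=
  ∑ i : ι, ∑ j : ι, Polynomial.C (π i j) •
    ((pderiv (Sum.inl i)).toLinearMap ∘ₗ (pderiv (Sum.inr j)).toLinearMap)

theorem piEnd_apply (π : ι → ι → k) (p : MvPolynomial (ι ⊕ ι) (Polynomial k)) :
    piEnd π p = piOp π p := by
  simp [piEnd, piOp, LinearMap.sum_apply]

theorem piEnd_pow_apply (π : ι → ι → k) (d : ℕ) (p : MvPolynomial (ι ⊕ ι) (Polynomial k)) :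
    (piEnd π ^ d) p = (piOp π)^[d] p := by
  rw [Module.End.pow_apply]
  congr 2
  exact funext (piEnd_apply π)

theorem totalDegree_piEnd_le (π : ι → ι → k) {p : MvPolynomial (ι ⊕ ι) (Polynomial k)} {n : ℕ}
    (h : p.totalDegree ≤ n + 1) : (piEnd π p).totalDegree ≤ n := by
  rw [piEnd_apply]
  refine totalDegree_finsetSum_le fun i _ => totalDegree_finsetSum_le fun j _ =>
    (totalDegree_smul_le _ _).trans ?_
  exact totalDegree_pderiv_le _ ((totalDegree_pderiv_le _ h).trans n.le_succ)

theorem piEnd_pow_eq_zero (π : ι → ι → k) (n : ℕ) {p : MvPolynomial (ι ⊕ ι) (Polynomial k)}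
    (h : p.totalDegree ≤ n) : (piEnd π ^ (n + 1)) p = 0 := by
  induction n generalizing p with
  | zero =>
    rw [Nat.le_zero, totalDegree_eq_zero_iff_eq_C] at h
    rw [h]
    simp [piEnd_apply, piOp]
  | succ n ih =>
    rw [pow_succ, Module.End.mul_apply]
    exact ih (totalDegree_piEnd_le π h)

/-- The coefficient `h ^ d / (2 ^ d * d!)` of the Moyal product. -/
def moyalCoeff (k : Type*) [Field k] (d : ℕ) : Polynomial k :=
  Polynomial.C ((2 ^ d * d.factorial : k)⁻¹) * Polynomial.X ^ d

theorem natCast_succ_mul_moyalCoeff (d : ℕ) :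
    ((d + 1 : ℕ) : Polynomial k) * moyalCoeff k (d + 1) = moyalCoeff k 1 * moyalCoeff k d := by
  have h : ((d + 1 : ℕ) : k) * ((2 ^ (d + 1) * (d + 1).factorial : k)⁻¹) =
      2⁻¹ * (2 ^ d * d.factorial : k)⁻¹ := by
    have h1 : ((d + 1 : ℕ) : k) ≠ 0 := Nat.cast_ne_zero.2 d.succ_ne_zero
    have h2 : (d.factorial : k) ≠ 0 := Nat.cast_ne_zero.2 d.factorial_ne_zero
    rw [Nat.factorial_succ, Nat.cast_mul]
    field_simp
    ring
  unfold moyalCoeff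
  rw [← mul_assoc, ← Polynomial.C_eq_natCast, ← Polynomial.C_mul, h, Polynomial.C_mul]
  simp
  ring

theorem moyalCoeff_one_add_self :
    moyalCoeff k 1 + moyalCoeff k 1 = Polynomial.X := by
  simp only [moyalCoeff, pow_one, Nat.factorial_one, Nat.cast_one, mul_one]
  rw [← add_mul, ← Polynomial.C_add, ← two_mul, mul_inv_cancel₀ two_ne_zero, Polynomial.C_1,
    one_mul]

/-- The truncated exponential `∑_{d < N} ((h/2) π)^d / d!`. -/
def moyalEnd (π : ι → ι → k) (N : ℕ) :
    Module.End (Polynomial k) (MvPolynomial (ι ⊕ ι) (Polynomial k)) :=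
  ∑ d ∈ Finset.range N, moyalCoeff k d • piEnd π ^ d

theorem moyalEnd_apply_eq (π : ι → ι → k) {p : MvPolynomial (ι ⊕ ι) (Polynomial k)} {N M : ℕ}
    (hN : p.totalDegree < N) (hNM : N ≤ M) : moyalEnd π M p = moyalEnd π N p := by
  simp only [moyalEnd, LinearMap.sum_apply, LinearMap.smul_apply]
  symm
  refine Finset.sum_subset (Finset.range_mono hNM) fun d _ hd => ?_
  rw [Finset.mem_range, not_lt] at hd
  obtain ⟨e, rfl⟩ : ∃ e, d = e + 1 := ⟨d - 1, by omega⟩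
  rw [piEnd_pow_eq_zero π e (by omega), smul_zero]

theorem totalDegree_tens_le (f g : MvPolynomial ι (Polynomial k)) :
    (tens f g).totalDegree ≤ f.totalDegree + g.totalDegree :=
  (totalDegree_mul _ _).trans
    (add_le_add (totalDegree_rename_le _ _) (totalDegree_rename_le _ _))

theorem moyal_eq_joinMul_moyalEnd (π : ι → ι → k) (f g : MvPolynomial ι (Polynomial k)) {N : ℕ}
    (hN : f.totalDegree + g.totalDegree < N) :
    moyal π f g = joinMul (moyalEnd π N (tens f g)) := by
  rw [moyalEnd_apply_eq π (Nat.lt_succ_of_le (totalDegree_tens_le f g)) hN]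
  simp only [moyal, moyalEnd, LinearMap.sum_apply, LinearMap.smul_apply, map_sum, map_smul,
    piEnd_pow_apply]
  rfl

theorem moyal_add_left (π : ι → ι → k) (f f' g : MvPolynomial ι (Polynomial k)) :
    moyal π (f + f') g = moyal π f g + moyal π f' g := by
  have h := totalDegree_add f f'
  rw [moyal_eq_joinMul_moyalEnd π _ _
      (N := f.totalDegree + f'.totalDegree + g.totalDegree + 1) (by grind),
    moyal_eq_joinMul_moyalEnd π f _
      (N := f.totalDegree + f'.totalDegree + g.totalDegree + 1) (by omega),
    moyal_eq_joinMul_moyalEnd π f' _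
      (N := f.totalDegree + f'.totalDegree + g.totalDegree + 1) (by omega),
    ← map_add, ← map_add]
  simp [tens, add_mul]

theorem moyal_smul_left (π : ι → ι → k) (c : Polynomial k) (f g : MvPolynomial ι (Polynomial k)) :
    moyal π (c • f) g = c • moyal π f g := by
  have h := totalDegree_smul_le c f
  rw [moyal_eq_joinMul_moyalEnd π _ _ (N := f.totalDegree + g.totalDegree + 1) (by omega),
    moyal_eq_joinMul_moyalEnd π f _ (N := f.totalDegree + g.totalDegree + 1) (by omega),
    ← map_smul, ← map_smul]
  simp [tens]

theorem joinMul_tens (f g : MvPolynomial ι (Polynomial k)) : joinMul (tens f g) = f * g := by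
  simp only [joinMul, tens, map_mul, aeval_rename]
  congr 1
  · exact aeval_X_left_apply f
  · exact aeval_X_left_apply g

theorem moyal_one_left (π : ι → ι → k) (g : MvPolynomial ι (Polynomial k)) :
    moyal π 1 g = g := by
  have h : piEnd π (tens 1 g) = 0 := by
    rw [piEnd_apply]
    refine Finset.sum_eq_zero fun i _ => Finset.sum_eq_zero fun j _ => ?_
    have : pderiv (Sum.inl i) (rename Sum.inr g : MvPolynomial (ι ⊕ ι) (Polynomial k)) = 0 := by
      refine pderiv_eq_zero_of_notMem_vars fun hi => ?_
      simpa using vars_rename Sum.inr g hi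
    rw [pderiv_comm]
    simp [tens, this]
  rw [moyal_eq_joinMul_moyalEnd π 1 g (Nat.lt_succ_self _)]
  simp only [moyalEnd, LinearMap.sum_apply, LinearMap.smul_apply]
  rw [Finset.sum_range_succ', Finset.sum_eq_zero]
  · simp [moyalCoeff, joinMul_tens]
  · intro d _
    rw [pow_succ, Module.End.mul_apply, h, map_zero, smul_zero]

/-- The derivation obtained by contracting row `i` of `π` with the partial derivatives. -/
def rowDeriv {τ : Type*} (π : ι → ι → k) (e : ι → τ) (i : ι) :
    Module.End (Polynomial k) (MvPolynomial τ (Polynomial k)) :=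
  ∑ j : ι, Polynomial.C (π i j) • (pderiv (e j)).toLinearMap

theorem rowDeriv_apply {τ : Type*} (π : ι → ι → k) (e : ι → τ) (i : ι)
    (p : MvPolynomial τ (Polynomial k)) :
    rowDeriv π e i p = ∑ j : ι, Polynomial.C (π i j) • pderiv (e j) p := by
  simp [rowDeriv, LinearMap.sum_apply]

theorem commute_rowDeriv_piEnd (π : ι → ι → k) (e : ι → ι ⊕ ι) (i : ι) :
    Commute (rowDeriv π e i) (piEnd π) := by
  have h (a b : ι ⊕ ι) : Commute
      ((pderiv a).toLinearMap : Module.End (Polynomial k) (MvPolynomial (ι ⊕ ι) (Polynomial k)))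
      (pderiv b).toLinearMap :=
    LinearMap.ext fun p => pderiv_comm a b p
  refine Commute.sum_left _ _ _ fun a _ => Commute.sum_right _ _ _ fun b _ =>
    Commute.sum_right _ _ _ fun c _ => ?_
  exact (((h _ _).mul_right (h _ _)).smul_left _).smul_right _

theorem commute_rowDeriv_moyalEnd (π : ι → ι → k) (e : ι → ι ⊕ ι) (i : ι) (N : ℕ) :
    Commute (rowDeriv π e i) (moyalEnd π N) :=
  Commute.sum_right _ _ _ fun d _ => ((commute_rowDeriv_piEnd π e i).pow_right d).smul_right _

theorem piEnd_mul_mulLeft (π : ι → ι → k) (i : ι) :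
    piEnd π * LinearMap.mulLeft (Polynomial k) (X (Sum.inl i)) =
      LinearMap.mulLeft (Polynomial k) (X (Sum.inl i)) * piEnd π + rowDeriv π Sum.inr i := by
  refine LinearMap.ext fun p => ?_
  simp only [Module.End.mul_apply, LinearMap.add_apply, piEnd_apply, rowDeriv_apply, piOp,
    LinearMap.mulLeft_apply]
  have h (a j : ι) : pderiv (Sum.inl a) (pderiv (Sum.inr j)
      (X (Sum.inl i) * p : MvPolynomial (ι ⊕ ι) (Polynomial k))) =
      X (Sum.inl i) * pderiv (Sum.inl a) (pderiv (Sum.inr j) p) +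
        if a = i then pderiv (Sum.inr j) p else 0 := by
    rw [pderiv_mul, pderiv_X_of_ne (by simp), zero_mul, zero_add, pderiv_mul]
    split_ifs with h
    · subst h
      rw [pderiv_X_self, one_mul, add_comm]
    · rw [pderiv_X_of_ne (by simpa using Ne.symm h), zero_mul, zero_add, add_zero]
  simp only [h, smul_add, Finset.sum_add_distrib, Finset.mul_sum, mul_smul_comm]
  congr 1
  rw [Finset.sum_eq_single i]
  · simp
  · intro b _ hb
    simp [hb]
  · simp

theorem piEnd_pow_succ_mul_mulLeft (π : ι → ι → k) (i : ι) (d : ℕ) :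
    piEnd π ^ (d + 1) * LinearMap.mulLeft (Polynomial k) (X (Sum.inl i)) =
      LinearMap.mulLeft (Polynomial k) (X (Sum.inl i)) * piEnd π ^ (d + 1) +
        ((d + 1 : ℕ) : Polynomial k) • (rowDeriv π Sum.inr i * piEnd π ^ d) := by
  induction d with
  | zero => simp [piEnd_mul_mulLeft]
  | succ d ih =>
    rw [pow_succ', mul_assoc, ih, mul_add, ← mul_assoc, piEnd_mul_mulLeft, mul_smul_comm,
      ← mul_assoc (piEnd π), ← (commute_rowDeriv_piEnd π Sum.inr i).eq, add_mul, mul_assoc,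
      mul_assoc, ← pow_succ', ← pow_succ', Nat.cast_succ (d + 1), add_smul, one_smul]
    abel

theorem moyalEnd_succ_mul_mulLeft (π : ι → ι → k) (i : ι) (N : ℕ) :
    moyalEnd π (N + 1) * LinearMap.mulLeft (Polynomial k) (X (Sum.inl i)) =
      LinearMap.mulLeft (Polynomial k) (X (Sum.inl i)) * moyalEnd π (N + 1) +
        moyalCoeff k 1 • (rowDeriv π Sum.inr i * moyalEnd π N) := by
  simp only [moyalEnd, Finset.sum_range_succ' _ N, add_mul, mul_add, Finset.sum_mul,
    Finset.mul_sum, smul_mul_assoc, mul_smul_comm, piEnd_pow_succ_mul_mulLeft, smul_add,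
    Finset.sum_add_distrib, Finset.smul_sum, smul_smul, pow_zero, one_mul, mul_one]
  simp only [mul_comm (moyalCoeff k (_ + 1)), natCast_succ_mul_moyalCoeff]
  abel

/-- Left Moyal multiplication by a variable. -/
def varMoyal (π : ι → ι → k) (i : ι) (g : MvPolynomial ι (Polynomial k)) :
    MvPolynomial ι (Polynomial k) :=
  X i * g + moyalCoeff k 1 • rowDeriv π id i g

theorem tens_varMoyal (π : ι → ι → k) (i : ι) (f g : MvPolynomial ι (Polynomial k)) :
    tens (varMoyal π i f) g =
      X (Sum.inl i) * tens f g + moyalCoeff k 1 • rowDeriv π Sum.inl i (tens f g) := by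
  have h (j : ι) : pderiv (Sum.inl j) (tens f g) = tens (pderiv j f) g := by
    have h0 : pderiv (Sum.inl j) (rename Sum.inr g : MvPolynomial (ι ⊕ ι) (Polynomial k)) = 0 := by
      refine pderiv_eq_zero_of_notMem_vars fun hi => ?_
      simpa using vars_rename Sum.inr g hi
    rw [tens, pderiv_mul, h0, mul_zero, add_zero, pderiv_rename Sum.inl_injective, tens]
  simp only [rowDeriv_apply, h, varMoyal]
  simp [tens, add_mul, mul_assoc, Finset.sum_mul]

theorem varMoyal_joinMul (π : ι → ι → k) (i : ι) (p : MvPolynomial (ι ⊕ ι) (Polynomial k)) :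
    varMoyal π i (joinMul p) = joinMul (X (Sum.inl i) * p +
      moyalCoeff k 1 • (rowDeriv π Sum.inl i p + rowDeriv π Sum.inr i p)) := by
  have hX : joinMul (X (Sum.inl i) : MvPolynomial (ι ⊕ ι) (Polynomial k)) = X i := by
    simp [joinMul]
  simp only [varMoyal, rowDeriv_apply, id_eq, pderiv_joinMul, map_add, map_mul, hX, map_smul,
    map_sum, ← Finset.sum_add_distrib, smul_add]

theorem moyal_varMoyal_left (π : ι → ι → k) (i : ι) (f g : MvPolynomial ι (Polynomial k)) :
    moyal π (varMoyal π i f) g = varMoyal π i (moyal π f g) := by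
  set N := (varMoyal π i f).totalDegree + f.totalDegree + g.totalDegree + 1
  have h1 := LinearMap.congr_fun (moyalEnd_succ_mul_mulLeft π i N) (tens f g)
  have h2 := LinearMap.congr_fun (commute_rowDeriv_moyalEnd π Sum.inl i (N + 1)).eq (tens f g)
  have h3 : moyalEnd π (N + 1) (tens f g) = moyalEnd π N (tens f g) :=
    moyalEnd_apply_eq π (by have := totalDegree_tens_le f g; omega) N.le_succ
  rw [moyal_eq_joinMul_moyalEnd π (varMoyal π i f) g (N := N + 1) (by omega),
    moyal_eq_joinMul_moyalEnd π f g (N := N + 1) (by omega), varMoyal_joinMul, tens_varMoyal]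
  simp only [Module.End.mul_apply, LinearMap.add_apply, LinearMap.smul_apply,
    LinearMap.mulLeft_apply] at h1 h2
  rw [map_add, map_smul, h1, ← h2, h3, smul_add]
  congr 1
  abel

end Moyal

section Quantization

variable {A : Type*} [Ring A] [Algebra (Polynomial k) A]

theorem eq_of_natCast_succ_smul_eq {n : ℕ} {u v : A}
    (h : ((n + 1 : ℕ) : Polynomial k) • u = ((n + 1 : ℕ) : Polynomial k) • v) : u = v := by
  have h1 : Polynomial.C (((n + 1 : ℕ) : k)⁻¹) * ((n + 1 : ℕ) : Polynomial k) = 1 := by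
    rw [← Polynomial.C_eq_natCast, ← Polynomial.C_mul,
      inv_mul_cancel₀ (Nat.cast_ne_zero.2 n.succ_ne_zero), Polynomial.C_1]
  simpa only [smul_smul, h1, one_smul] using
    congrArg (fun w => Polynomial.C (((n + 1 : ℕ) : k)⁻¹) • w) h

/-- A linear map that intertwines the Euler operators intertwines multiplication by variables
with left Moyal multiplication by variables. -/
theorem map_varMoyal_of_euler {π : ι → ι → k} {x : ι → A}
    (hx : ∀ i j, x i * x j - x j * x i =
      algebraMap (Polynomial k) A (Polynomial.X * Polynomial.C (π i j)))
    (φ : MvPolynomial ι (Polynomial k) →ₗ[Polynomial k] A)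
    (hφ : ∀ g, φ (∑ i, X i * pderiv i g) = ∑ i, x i * φ (pderiv i g))
    (i : ι) (g : MvPolynomial ι (Polynomial k)) :
    φ (varMoyal π i g) = x i * φ g := by
  have key (n : ℕ) : ∀ g : MvPolynomial ι (Polynomial k), g.IsHomogeneous n →
      φ (varMoyal π i g) = x i * φ g := by
    induction n with
    | zero =>
      intro g hg
      rw [← totalDegree_zero_iff_isHomogeneous, totalDegree_eq_zero_iff_eq_C] at hg
      have h := hφ (X i * g)
      rw [hg] at h ⊢
      have hd : (X i * C (coeff 0 g) : MvPolynomial ι (Polynomial k)).IsHomogeneous 1 :=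
        (isHomogeneous_X (Polynomial k) i).mul (isHomogeneous_C ι _)
      rw [hd.sum_X_mul_pderiv, one_smul] at h
      rw [varMoyal, rowDeriv_apply]
      simp only [pderiv_C, smul_zero, Finset.sum_const_zero, add_zero, h]
      rw [Finset.sum_eq_single i]
      · simp
      · intro j _ hj
        simp [pderiv_X_of_ne (Ne.symm hj)]
      · simp
    | succ n ih =>
      intro g hg
      set c := moyalCoeff k 1
      set r := rowDeriv π (id : ι → ι) i
      have hdg (j : ι) : (pderiv j g).IsHomogeneous n := hg.pderiv
      have hrg : (r g).IsHomogeneous n := by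
        rw [rowDeriv_apply]
        refine IsHomogeneous.sum _ _ _ fun j _ => ?_
        rw [smul_eq_C_mul]
        exact (hdg j).C_mul _
      have hr (j : ι) : r (pderiv j g) = pderiv j (r g) := by
        simp only [r, rowDeriv_apply, map_sum, id_eq]
        exact Finset.sum_congr rfl fun l _ => by rw [pderiv_comm, Derivation.map_smul]
      have h1 : ((n + 2 : ℕ) : Polynomial k) • φ (X i * g) =
          x i * φ g + ∑ j, x j * φ (X i * pderiv j g) := by
        have h := hφ (X i * g)
        have hd : (X i * g).IsHomogeneous (n + 2) := by
          have := (isHomogeneous_X (Polynomial k) i).mul hg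
          rwa [add_comm] at this
        rw [hd.sum_X_mul_pderiv, map_nsmul] at h
        rw [Nat.cast_smul_eq_nsmul, h]
        have h2 (j : ι) : pderiv j (X i * g) =
            (if j = i then g else 0) + X i * pderiv j g := by
          rw [pderiv_mul]
          split_ifs with hj
          · subst hj
            rw [pderiv_X_self, one_mul]
          · rw [pderiv_X_of_ne (Ne.symm hj), zero_mul]
        simp only [h2, map_add, mul_add, Finset.sum_add_distrib]
        congr 1
        rw [Finset.sum_eq_single i]
        · simp
        · intro j _ hj
          simp [hj]
        · simp
      have h3 (j : ι) : φ (X i * pderiv j g) =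
          x i * φ (pderiv j g) - c • φ (pderiv j (r g)) := by
        rw [← ih _ (hdg j), ← hr]
        simp only [varMoyal, map_add, map_smul]
        exact (add_sub_cancel_right _ _).symm
      have h4 : ∑ j, x j * (x i * φ (pderiv j g)) =
          ((n + 1 : ℕ) : Polynomial k) • (x i * φ g) - Polynomial.X (R := k) • φ (r g) := by
        have h (j : ι) : x j * (x i * φ (pderiv j g)) = x i * (x j * φ (pderiv j g)) -
            Polynomial.X (R := k) • Polynomial.C (π i j) • φ (pderiv j g) := by
          rw [smul_smul, Algebra.smul_def, ← hx]
          noncomm_ring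
        have hE := hφ g
        rw [hg.sum_X_mul_pderiv, map_nsmul] at hE
        simp only [h, Finset.sum_sub_distrib, ← Finset.mul_sum, ← Finset.smul_sum, ← hE]
        simp only [r, rowDeriv_apply, map_sum, map_smul, id_eq]
        rw [Nat.cast_smul_eq_nsmul, mul_smul_comm]
      have h5 : ∑ j, x j * φ (pderiv j (r g)) = (n : Polynomial k) • φ (r g) := by
        rw [← hφ, hrg.sum_X_mul_pderiv, map_nsmul, Nat.cast_smul_eq_nsmul]
      refine eq_of_natCast_succ_smul_eq (k := k) (n := n + 1) ?_
      rw [varMoyal, map_add, smul_add, map_smul, h1]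
      simp only [h3, mul_sub, Finset.sum_sub_distrib, mul_smul_comm, ← Finset.smul_sum, h4, h5,
        ← moyalCoeff_one_add_self (k := k)]
      change _ + _ + _ • c • φ (r g) = _
      push_cast
      module
  rw [← sum_homogeneousComponent g]
  have hadd : (φ (varMoyal π i (∑ n ∈ Finset.range (g.totalDegree + 1),
      homogeneousComponent n g))) = ∑ n ∈ Finset.range (g.totalDegree + 1),
        φ (varMoyal π i (homogeneousComponent n g)) := by
    simp only [varMoyal, Finset.mul_sum, map_sum, Finset.smul_sum, ← Finset.sum_add_distrib]
  rw [hadd, map_sum, Finset.mul_sum]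
  exact Finset.sum_congr rfl fun n _ => key n _ (homogeneousComponent_isHomogeneous n g)

theorem map_moyal_of_map_varMoyal {π : ι → ι → k} {x : ι → A}
    (φ : MvPolynomial ι (Polynomial k) →ₗ[Polynomial k] A) (h_one : φ 1 = 1)
    (hφ : ∀ i g, φ (varMoyal π i g) = x i * φ g) (f g : MvPolynomial ι (Polynomial k)) :
    φ (moyal π f g) = φ f * φ g := by
  have hadd (f f' : MvPolynomial ι (Polynomial k)) (h : φ (moyal π f g) = φ f * φ g)
      (h' : φ (moyal π f' g) = φ f' * φ g) : φ (moyal π (f + f') g) = φ (f + f') * φ g := by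
    rw [moyal_add_left, map_add, map_add, h, h', add_mul]
  have hsmul (c : Polynomial k) (f : MvPolynomial ι (Polynomial k))
      (h : φ (moyal π f g) = φ f * φ g) : φ (moyal π (c • f) g) = φ (c • f) * φ g := by
    rw [moyal_smul_left, map_smul, map_smul, h, smul_mul_assoc]
  have hC (a : Polynomial k) : φ (moyal π (C a) g) = φ (C a) * φ g := by
    have := hsmul a 1 (by rw [moyal_one_left, h_one, one_mul])
    rwa [smul_eq_C_mul, mul_one] at this
  have key (n : ℕ) : ∀ f : MvPolynomial ι (Polynomial k), f.totalDegree ≤ n →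
      φ (moyal π f g) = φ f * φ g := by
    induction n with
    | zero =>
      intro f hf
      rw [Nat.le_zero, totalDegree_eq_zero_iff_eq_C] at hf
      rw [hf]
      exact hC _
    | succ n ih =>
      intro f hf
      rw [f.as_sum]
      refine Finset.sum_induction _ (fun f => φ (moyal π f g) = φ f * φ g) hadd
        (by simpa using hC 0) fun m hm => ?_
      generalize coeff m f = a
      by_cases h0 : m = 0
      · rw [h0]
        exact hC a
      obtain ⟨i, hi⟩ := Finsupp.ne_iff.1 h0
      obtain ⟨m', rfl⟩ : ∃ m', m = m' + Finsupp.single i 1 :=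
        ⟨m - Finsupp.single i 1, (tsub_add_cancel_of_le
          (Finsupp.single_le_iff.2 (Nat.one_le_iff_ne_zero.2 hi))).symm⟩
      have hm' : (monomial m' a).totalDegree ≤ n := by
        refine (totalDegree_monomial_le _ _).trans ?_
        have := (le_totalDegree hm).trans hf
        rw [Finsupp.sum_add_index' (by simp) (by simp), Finsupp.sum_single_index rfl] at this
        exact Nat.le_of_succ_le_succ this
      have hr : (rowDeriv π id i (monomial m' a)).totalDegree ≤ n := by
        rw [rowDeriv_apply]
        exact totalDegree_finsetSum_le fun j _ => (totalDegree_smul_le _ _).trans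
          (totalDegree_pderiv_le _ (hm'.trans n.le_succ))
      have hmon : monomial (m' + Finsupp.single i 1) a = varMoyal π i (monomial m' a) +
          (-moyalCoeff k 1) • rowDeriv π id i (monomial m' a) := by
        rw [varMoyal, neg_smul, add_neg_cancel_right, add_comm m', monomial_single_add, pow_one]
      rw [hmon]
      refine hadd _ _ ?_ (hsmul _ _ (ih _ hr))
      rw [moyal_varMoyal_left, hφ, hφ, ih _ hm', mul_assoc]
  exact key _ f le_rfl

end Quantization

section Weyl

/-- The image of a variable in the Weyl algebra. -/
def weylVar (π : ι → ι → k) (i : ι) : Weyl π :=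
  RingQuot.mkAlgHom (Polynomial k) (weylRel π) (FreeAlgebra.ι (Polynomial k) i)

theorem weylVar_commutator (π : ι → ι → k) (i j : ι) :
    weylVar π i * weylVar π j - weylVar π j * weylVar π i =
      algebraMap (Polynomial k) (Weyl π) (Polynomial.X * Polynomial.C (π i j)) := by
  have h := RingQuot.mkAlgHom_rel (Polynomial k) (weylRel.comm (π := π) i j)
  rwa [map_sub, map_mul, map_mul, AlgHom.commutes] at h

theorem symMon_eq_smul_multisetPermSum (π : ι → ι → k) (m : ι →₀ ℕ) :
    symMon π m = Polynomial.C (((Finsupp.toMultiset m).card.factorial : k)⁻¹) •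
      multisetPermSum (weylVar π) (Finsupp.toMultiset m) := by
  rw [Algebra.smul_def, ← Multiset.length_toList]
  rfl

theorem symMon_zero (π : ι → ι → k) : symMon π 0 = 1 := by
  rw [symMon_eq_smul_multisetPermSum, map_zero, multisetPermSum_zero]
  simp

theorem degree_smul_symMon (π : ι → ι → k) (m : ι →₀ ℕ) :
    (m.degree : Polynomial k) • symMon π m =
      ∑ i, (m i : Polynomial k) • (weylVar π i * symMon π (m - Finsupp.single i 1)) := by
  by_cases h0 : m = 0
  · simp [h0]
  have hM : Finsupp.toMultiset m ≠ 0 := fun h =>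
    h0 (Finsupp.ext fun i => by rw [← Finsupp.count_toMultiset, h]; rfl)
  obtain ⟨n, hn⟩ := Nat.exists_eq_succ_of_ne_zero (Multiset.card_eq_zero.not.2 hM)
  have hdeg : m.degree = n + 1 := by
    rw [← Nat.succ_eq_add_one, ← hn, Finsupp.card_toMultiset]
    rfl
  have hcoeff : ((n + 1 : ℕ) : Polynomial k) * Polynomial.C (((n + 1).factorial : k)⁻¹) =
      Polynomial.C ((n.factorial : k)⁻¹) := by
    rw [← Polynomial.C_eq_natCast, ← Polynomial.C_mul, Nat.factorial_succ, Nat.cast_mul,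
      mul_inv, mul_inv_cancel_left₀ (Nat.cast_ne_zero.2 n.succ_ne_zero)]
  rw [symMon_eq_smul_multisetPermSum, hn, hdeg, smul_smul, Nat.succ_eq_add_one, hcoeff,
    multisetPermSum_eq_sum_erase _ hM, Finset.sum_multiset_map_count, Finset.smul_sum]
  refine Finset.sum_subset_zero_on_sdiff (Finset.subset_univ _) ?_ ?_
  · intro i hi
    have : m i = 0 := by simpa using hi
    simp [this]
  · intro i hi
    have herase : Finsupp.toMultiset (m - Finsupp.single i 1) =
        (Finsupp.toMultiset m).erase i := by
      ext j
      rw [Finsupp.count_toMultiset, Finsupp.tsub_apply, ← Multiset.sub_singleton,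
        Multiset.count_sub, Finsupp.count_toMultiset, Multiset.count_singleton,
        Finsupp.single_apply]
      simp only [eq_comm]
    rw [symMon_eq_smul_multisetPermSum, herase,
      Multiset.card_erase_of_mem (Multiset.mem_toFinset.1 hi), hn, Finsupp.count_toMultiset,
      mul_smul_comm, smul_comm, Nat.cast_smul_eq_nsmul, Nat.pred_succ]

/-- The symmetrization map as a linear map. -/
def phiWLinear (π : ι → ι → k) : MvPolynomial ι (Polynomial k) →ₗ[Polynomial k] Weyl π :=
  (basisMonomials ι (Polynomial k)).constr (Polynomial k) (symMon π)

theorem phiWLinear_monomial (π : ι → ι → k) (m : ι →₀ ℕ) (a : Polynomial k) :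
    phiWLinear π (monomial m a) = a • symMon π m := by
  have h := (basisMonomials ι (Polynomial k)).constr_basis (Polynomial k) (symMon π) m
  rw [coe_basisMonomials] at h
  rw [← mul_one a, ← smul_eq_mul, ← smul_monomial, map_smul, smul_eq_mul, mul_one]
  exact congrArg (a • ·) h

theorem phiWLinear_apply (π : ι → ι → k) (f : MvPolynomial ι (Polynomial k)) :
    phiWLinear π f = phiW π f := by
  conv_lhs => rw [f.as_sum]
  simp only [map_sum, phiWLinear_monomial, phiW]

theorem phiWLinear_euler (π : ι → ι → k) (g : MvPolynomial ι (Polynomial k)) :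
    phiWLinear π (∑ i, X i * pderiv i g) = ∑ i, weylVar π i * phiWLinear π (pderiv i g) := by
  induction g using MvPolynomial.induction_on' with
  | monomial m a =>
    rw [(isHomogeneous_monomial a rfl).sum_X_mul_pderiv, map_nsmul, phiWLinear_monomial,
      ← Nat.cast_smul_eq_nsmul (Polynomial k), smul_comm, degree_smul_symMon, Finset.smul_sum]
    refine Finset.sum_congr rfl fun i _ => ?_
    rw [pderiv_monomial, phiWLinear_monomial, mul_smul_comm, mul_smul]
  | add p q hp hq =>
    simp only [map_add, mul_add, Finset.sum_add_distrib, hp, hq]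

end Weyl

/-- transporting the Weyl algebra multiplication through the
symmetrization map yields the Moyal product: `φ_W(f *ₕ g) = φ_W(f)·φ_W(g)`. -/
theorem phiW_moyal (π : ι → ι → k) (hπ : ∀ i j, π j i = -π i j)
    (hnd : (Matrix.of π).det ≠ 0)
    (f g : MvPolynomial ι (Polynomial k)) :
    phiW π (moyal π f g) = phiW π f * phiW π g := by
  simp only [← phiWLinear_apply]
  have h_one : phiWLinear π 1 = 1 := by
    rw [← C_1, C_apply, phiWLinear_monomial, symMon_zero, one_smul]
  have h_var (i : ι) (g : MvPolynomial ι (Polynomial k)) :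
      phiWLinear π (varMoyal π i g) = weylVar π i * phiWLinear π g :=
    map_varMoyal_of_euler (A := Weyl π) (π := π) (x := weylVar π) (weylVar_commutator π)
      (phiWLinear π) (phiWLinear_euler π) i g
  exact map_moyal_of_map_varMoyal (A := Weyl π) (π := π) (x := weylVar π)
    (phiWLinear π) h_one h_var f g
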